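/- arXiv:1512.08816 — 3 statements merged into one kernel-verified Lean document; each statement's English description precedes it below -/
import Mathlib

section
/- Let A be a C*-algebra and let I_0, …, I_n be closed two-sided ideals of A. Suppose that a_0, …, a_n ∈ A satisfy a_i − a_j ∈ I_i + I_j for all i, j ∈ {0, …, n}. Then there exists a ∈ A such that a − a_i ∈ I_i for every i ∈ {0, …, n}. -/
/-- A local approximate unit `u = z⋆ z w` for a single element `z` of a C⋆-algebra. -/
lemma exists_local_unit {A : Type*} [NonUnitalCStarAlgebra A] (z : A) {ε : ℝ} (hε : 0 < ε) :
    ∃ w : A, ‖z - z * (star z * z * w)‖ ≤ ε ∧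
      ∀ b : A, ‖b - b * (star z * z * w)‖ ≤ ‖b‖ := by
  let _ := CStarAlgebra.spectralOrder A
  have _ := CStarAlgebra.spectralOrderedRing A
  set h : A := star z * z with hh
  have hsa : IsSelfAdjoint h := IsSelfAdjoint.star_mul_self z
  have hpos : 0 ≤ h := star_mul_self_nonneg z
  set η : ℝ := ε ^ 2 with hη
  have hη0 : 0 < η := by positivity
  have hden : ∀ t : ℝ, t ^ 2 + η ^ 2 ≠ 0 := fun t => by positivity
  set g : ℝ → ℝ := fun t => t / (t ^ 2 + η ^ 2) with hg
  have hgc : Continuous g := by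
    apply Continuous.div <;> first | fun_prop | exact hden
  have hg0 : g 0 = 0 := by simp [hg]
  set f : ℝ → ℝ := fun t => t * g t with hf
  have hfc : Continuous f := by fun_prop
  have hf0 : f 0 = 0 := by simp [hf]
  have hf_nonneg : ∀ t, 0 ≤ f t := fun t => by
    have : f t = t ^ 2 / (t ^ 2 + η ^ 2) := by simp only [hf, hg]; ring
    rw [this]; positivity
  have hf_sub : ∀ t, 1 - f t = η ^ 2 / (t ^ 2 + η ^ 2) := fun t => by
    have := hden t
    simp only [hf, hg]; field_simp; ring
  have hf_le : ∀ t, f t ≤ 1 := fun t => by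
    have := hf_sub t
    have h2 : 0 ≤ η ^ 2 / (t ^ 2 + η ^ 2) := by positivity
    linarith
  have hhid : cfcₙ (fun t : ℝ => t) h = h := cfcₙ_id' ℝ h hsa
  set u : A := cfcₙ f h with hu
  have hu_eq : h * cfcₙ g h = u := by
    rw [hu, hf, cfcₙ_mul (fun t : ℝ => t) g h (by fun_prop) rfl hgc.continuousOn hg0, hhid]
  have hu_sa : star u = u := (cfcₙ_predicate f h : IsSelfAdjoint _)
  refine ⟨cfcₙ g h, ?_, ?_⟩
  · rw [hu_eq]
    have key : star (z - z * u) * (z - z * u)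
        = cfcₙ (fun t : ℝ => t - t * f t - (f t * t - f t * t * f t)) h := by
      rw [cfcₙ_sub (fun t : ℝ => t - t * f t) (fun t => f t * t - f t * t * f t) h
          (by fun_prop) (by simp) (by fun_prop) (by simp),
        cfcₙ_sub (fun t : ℝ => t) (fun t => t * f t) h
          (by fun_prop) (by simp) (by fun_prop) (by simp),
        cfcₙ_sub (fun t : ℝ => f t * t) (fun t => f t * t * f t) h
          (by fun_prop) (by simp) (by fun_prop) (by simp),
        cfcₙ_mul (fun t : ℝ => f t * t) f h (by fun_prop) (by simp) (by fun_prop) hf0,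
        cfcₙ_mul f (fun t : ℝ => t) h (by fun_prop) hf0 (by fun_prop) (by simp),
        cfcₙ_mul (fun t : ℝ => t) f h (by fun_prop) (by simp) (by fun_prop) hf0,
        hhid, ← hu, hh, star_sub, star_mul, hu_sa]
      noncomm_ring
    have hb : ‖star (z - z * u) * (z - z * u)‖ ≤ η := by
      rw [key]
      apply norm_cfcₙ_le
      intro t _
      have e : t - t * f t - (f t * t - f t * t * f t) = (t * (1 - f t)) * (1 - f t) := by ring
      rw [e, norm_mul]
      have h1 : ‖1 - f t‖ ≤ 1 := by
        rw [Real.norm_eq_abs, abs_le]; constructor <;> linarith [hf_nonneg t, hf_le t]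
      have h2 : ‖t * (1 - f t)‖ ≤ η := by
        rw [hf_sub, Real.norm_eq_abs, abs_le, mul_div_assoc', le_div_iff₀ (by positivity),
          div_le_iff₀ (by positivity)]
        constructor <;>
          nlinarith [mul_nonneg hη0.le (sq_nonneg (t - η)), mul_nonneg hη0.le (sq_nonneg (t + η)),
            mul_nonneg hη0.le (sq_nonneg t), mul_nonneg hη0.le (sq_nonneg η)]
      calc _ ≤ η * 1 := mul_le_mul h2 h1 (norm_nonneg _) hη0.le
        _ = η := mul_one _
    rw [CStarRing.norm_star_mul_self, ← sq, hη] at hb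
    exact (abs_le_of_sq_le_sq' hb hε.le).2
  · intro b
    rw [hu_eq]
    have hv : 0 ≤ cfcₙ (fun t : ℝ => f t + f t - f t * f t) h :=
      cfcₙ_nonneg fun t _ => by nlinarith [hf_nonneg t, hf_le t]
    have hv' : cfcₙ (fun t : ℝ => f t + f t - f t * f t) h = u + u - u * u := by
      rw [cfcₙ_sub (fun t : ℝ => f t + f t) (fun t => f t * f t) h
          (by fun_prop) (by simp [hf0]) (by fun_prop) (by simp [hf0]),
        cfcₙ_mul f f h (by fun_prop) hf0 (by fun_prop) hf0,
        cfcₙ_add f f h (by fun_prop) hf0 (by fun_prop) hf0]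
    rw [hv'] at hv
    have h3 := star_right_conjugate_nonneg hv b
    have e : (b - b * u) * star (b - b * u) = b * star b - b * (u + u - u * u) * star b := by
      rw [star_sub, star_mul, hu_sa]; noncomm_ring
    have h4 : ‖(b - b * u) * star (b - b * u)‖ ≤ ‖b * star b‖ := by
      apply CStarAlgebra.norm_le_norm_of_nonneg_of_le (mul_star_self_nonneg _)
      rw [e]; exact sub_le_self _ h3
    rw [CStarRing.norm_self_mul_star, CStarRing.norm_self_mul_star, ← sq, ← sq] at h4
    exact (abs_le_of_sq_le_sq' h4 (norm_nonneg _)).2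

/-- The sum of two closed ideals is closed (in the form of approximation by elements). -/
lemma mem_add_of_approx {A : Type*} [NonUnitalCStarAlgebra A] (I K : TwoSidedIdeal A)
    (hI : IsClosed (I : Set A)) (hK : IsClosed (K : Set A)) (z : A)
    (hz : ∀ ε > 0, ∃ x ∈ I, ∃ y ∈ K, ‖z - (x + y)‖ ≤ ε) :
    ∃ x ∈ I, ∃ y ∈ K, z = x + y := by
  let I' : AddSubgroup A := AddSubgroup.ofClass I
  let K' : AddSubgroup A := AddSubgroup.ofClass K
  have : CompleteSpace I' := IsClosed.completeSpace_coe (s := (I : Set A)) (hs := hI)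
  have : CompleteSpace K' := IsClosed.completeSpace_coe (s := (K : Set A)) (hs := hK)
  let φ : I' × K' →+ A := (I'.subtype).coprod K'.subtype
  have hφ : ∀ p : I' × K', φ p = (p.1 : A) + (p.2 : A) := fun p => rfl
  let F : NormedAddGroupHom (I' × K') A := φ.mkNormedAddGroupHom 2 (by
    intro p
    rw [hφ]
    have h1 : ‖(p.1 : A)‖ ≤ ‖p‖ := norm_fst_le p
    have h2 : ‖(p.2 : A)‖ ≤ ‖p‖ := norm_snd_le p
    linarith [norm_add_le (p.1 : A) (p.2 : A)])
  have hF : ∀ p : I' × K', F p = (p.1 : A) + (p.2 : A) := fun p => rfl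
  have hs : F.SurjectiveOnWith φ.range 3 := by
    rintro _ ⟨⟨⟨i, hi⟩, ⟨k, hk⟩⟩, rfl⟩
    have hi : i ∈ I := hi
    have hk : k ∈ K := hk
    rw [hφ]
    dsimp only
    by_cases h0 : i + k = 0
    · exact ⟨0, by simp [h0]⟩
    obtain ⟨w, hw1, hw2⟩ := exists_local_unit k (norm_pos_iff.mpr h0)
    set u := star k * k * w with hu
    have huK : u ∈ K := K.mul_mem_right _ _ (K.mul_mem_left _ _ hk)
    have h1 : i - i * u ∈ I := sub_mem hi (I.mul_mem_right _ _ hi)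
    have h2 : k + i * u ∈ K := add_mem hk (K.mul_mem_left _ _ huK)
    have h3 : ‖i - i * u‖ ≤ 2 * ‖i + k‖ := by
      have e : i - i * u = ((i + k) - (i + k) * u) - (k - k * u) := by noncomm_ring
      rw [e]
      linarith [norm_sub_le ((i + k) - (i + k) * u) (k - k * u), hw2 (i + k)]
    have h4 : ‖k + i * u‖ ≤ 3 * ‖i + k‖ := by
      have e : k + i * u = (i + k) - (i - i * u) := by noncomm_ring
      rw [e]
      linarith [norm_sub_le (i + k) (i - i * u)]
    refine ⟨(⟨i - i * u, h1⟩, ⟨k + i * u, h2⟩), ?_, ?_⟩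
    · rw [hF]; dsimp only; abel
    · refine max_le ?_ h4
      exact h3.trans (by linarith [norm_nonneg (i + k)])
  have hc := controlled_closure_of_complete (by norm_num) one_pos hs
  have hzc : z ∈ φ.range.topologicalClosure := by
    change z ∈ closure (φ.range : Set A)
    rw [Metric.mem_closure_iff]
    intro ε hε
    obtain ⟨x, hx, y, hy, hxy⟩ := hz (ε / 2) (by positivity)
    refine ⟨x + y, ⟨(⟨x, hx⟩, ⟨y, hy⟩), rfl⟩, ?_⟩
    rw [dist_eq_norm]; linarith
  obtain ⟨p, hp, -⟩ := hc z hzc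
  exact ⟨p.1, p.1.2, p.2, p.2.2, by rw [← hp, hF]⟩

/-- Distributivity of the ideal lattice. -/
lemma mem_inf_add {A : Type*} [NonUnitalCStarAlgebra A] (I J K : TwoSidedIdeal A)
    (hI : IsClosed (I : Set A)) (hJ : IsClosed (J : Set A)) (hK : IsClosed (K : Set A)) (z : A)
    (h1 : ∃ x ∈ I, ∃ y ∈ K, z = x + y) (h2 : ∃ x ∈ J, ∃ y ∈ K, z = x + y) :
    ∃ x ∈ I ⊓ J, ∃ y ∈ K, z = x + y := by
  refine mem_add_of_approx (I ⊓ J) K ?_ hK z ?_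
  · have : ((I ⊓ J : TwoSidedIdeal A) : Set A) = (I : Set A) ∩ J := by
      ext x; simp [TwoSidedIdeal.mem_inf]
    rw [this]; exact hI.inter hJ
  intro ε hε
  obtain ⟨x, hx, k, hk, e1⟩ := h1
  obtain ⟨y, hy, l, hl, e2⟩ := h2
  obtain ⟨w, hw, -⟩ := exists_local_unit z hε
  refine ⟨x * (star z * y * w), ?_, x * (star z * l * w) + k * (star z * z * w), ?_, ?_⟩
  · rw [TwoSidedIdeal.mem_inf]
    exact ⟨I.mul_mem_right _ _ hx,
      J.mul_mem_left _ _ (J.mul_mem_right _ _ (J.mul_mem_left _ _ hy))⟩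
  · exact add_mem (K.mul_mem_left _ _ (K.mul_mem_right _ _ (K.mul_mem_left _ _ hl)))
      (K.mul_mem_right _ _ hk)
  · have e : x * (star z * y * w) + (x * (star z * l * w) + k * (star z * z * w))
        = z * (star z * z * w) := by
      have e3 : star z * z * w = star z * y * w + star z * l * w := by
        nth_rewrite 2 [e2]; noncomm_ring
      have e4 : z * (star z * z * w) = x * (star z * z * w) + k * (star z * z * w) := by
        rw [← add_mul, ← e1]
      rw [e4, ← add_assoc, ← mul_add, ← e3]
    rw [e]; exact hw

lemma mem_iInf_add {A : Type*} [NonUnitalCStarAlgebra A] (K : TwoSidedIdeal A)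
    (hK : IsClosed (K : Set A)) (z : A) (n : ℕ) (I : Fin (n + 1) → TwoSidedIdeal A)
    (hI : ∀ i, IsClosed (I i : Set A)) (h : ∀ i, ∃ x ∈ I i, ∃ y ∈ K, z = x + y) :
    ∃ x ∈ ⨅ i, I i, ∃ y ∈ K, z = x + y := by
  induction n with
  | zero =>
    obtain ⟨x, hx, y, hy, e⟩ := h 0
    refine ⟨x, ?_, y, hy, e⟩
    rw [TwoSidedIdeal.mem_iInf]
    intro i
    rwa [show i = 0 from Fin.ext (by omega)]
  | succ n ih =>
    have h1 := ih (fun i => I i.castSucc) (fun i => hI _) (fun i => h _)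
    have hcl : IsClosed ((⨅ i : Fin (n + 1), I i.castSucc : TwoSidedIdeal A) : Set A) := by
      have : ((⨅ i : Fin (n + 1), I i.castSucc : TwoSidedIdeal A) : Set A)
          = ⋂ i : Fin (n + 1), (I i.castSucc : Set A) := by
        ext x; simp [TwoSidedIdeal.mem_iInf]
      rw [this]; exact isClosed_iInter fun i => hI _
    obtain ⟨x, hx, y, hy, e⟩ := mem_inf_add _ _ K hcl (hI (Fin.last (n + 1))) hK z h1 (h _)
    refine ⟨x, ?_, y, hy, e⟩
    rw [TwoSidedIdeal.mem_inf, TwoSidedIdeal.mem_iInf] at hx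
    rw [TwoSidedIdeal.mem_iInf]
    intro i
    induction i using Fin.lastCases with
    | last => exact hx.2
    | cast i => exact hx.1 i


/-- Let `A` be a C*-algebra and `I 0, …, I n` closed two-sided ideals of `A`.
If elements `a 0, …, a n` of `A` satisfy `a i - a j ∈ I i + I j` (algebraic sum) for all `i, j`,
then there is a single element `b ∈ A` with `b - a i ∈ I i` for every `i`. -/
theorem common_lift_of_pairwise_congruent
    {A : Type*} [NonUnitalNormedRing A] [StarRing A] [CStarRing A]
    [CompleteSpace A] [NormedSpace ℂ A] [IsScalarTower ℂ A A] [SMulCommClass ℂ A A]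
    [StarModule ℂ A]
    (n : ℕ) (I : Fin (n + 1) → TwoSidedIdeal A)
    (hclosed : ∀ i, IsClosed (I i : Set A))
    (a : Fin (n + 1) → A)
    (h : ∀ i j, ∃ x ∈ I i, ∃ y ∈ I j, a i - a j = x + y) :
    ∃ b : A, ∀ i, b - a i ∈ I i := by
  let _ : NonUnitalCStarAlgebra A := {}
  induction n with
  | zero =>
    refine ⟨a 0, fun i => ?_⟩
    rw [show i = 0 from Fin.ext (by omega), sub_self]
    exact zero_mem _
  | succ n ih =>
    obtain ⟨b, hb⟩ := ih (fun i => I i.castSucc) (fun i => hclosed _) (fun i => a i.castSucc)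
      (fun i j => h _ _)
    obtain ⟨x, hx, y, hy, e⟩ := mem_iInf_add (I (Fin.last (n + 1))) (hclosed _)
      (b - a (Fin.last (n + 1))) n (fun i => I i.castSucc) (fun i => hclosed _) (by
        intro i
        obtain ⟨x, hx, y, hy, e⟩ := h i.castSucc (Fin.last (n + 1))
        refine ⟨(b - a i.castSucc) + x, add_mem (hb i) hx, y, hy, ?_⟩
        rw [add_assoc, ← e]; abel)
    rw [TwoSidedIdeal.mem_iInf] at hx
    refine ⟨b - x, fun i => ?_⟩
    induction i using Fin.lastCases with
    | last =>
      have : b - x - a (Fin.last (n + 1)) = y := by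
        rw [sub_right_comm, e]; abel
      rw [this]; exact hy
    | cast i =>
      rw [sub_right_comm]
      exact sub_mem (hb i) (hx i)
end

section
/- Let A be a unital C*-algebra and let w_0, …, w_N ∈ A be isometries (w_i* w_i = 1) that doubly commute, i.e. w_i w_j = w_j w_i and w_i* w_j = w_j w_i* for all i ≠ j. Set R := ∏_{j=0}^N (1 − w_j w_j*) (product taken in increasing order of j), and for p = (p_0, …, p_N) ∈ ℕ^{N+1} set W_p := ∏_{i=0}^N w_i^{p_i}. Then: (i) w_i* R = 0 and R w_i = 0 for every i; (ii) W_p* R = 0 = R W_p for every p ∈ ℕ^{N+1} with p ≠ 0; (iii) (W_p R W_q*)(W_a R W_b*) = δ_{q,a} W_p R W_b* for all p, q, a, b ∈ ℕ^{N+1}, where δ_{q,a} is 1 if q = a and 0 otherwise; (iv) (W_p R W_q*)* = W_q R W_p* for all p, q ∈ ℕ^{N+1}. -/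
/-- The ordered product `R = ∏_{j=0}^{N} (1 - w j * (w j)*)`, taken in increasing order of `j`. -/
def defectProd {A : Type*} [Ring A] [StarRing A] {N : ℕ} (w : Fin (N + 1) → A) : A :=
  ((List.finRange (N + 1)).map fun j => 1 - w j * star (w j)).prod

/-- The ordered product `W p = ∏_{i=0}^{N} (w i) ^ (p i)`, taken in increasing order of `i`. -/
def multiPow {A : Type*} [Monoid A] {N : ℕ} (w : Fin (N + 1) → A)
    (p : Fin (N + 1) → ℕ) : A :=
  ((List.finRange (N + 1)).map fun i => w i ^ p i).prod

theorem aux_commute_prod {A ι : Type*} [Monoid A] (f : ι → A) (x : A) (l : List ι)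
    (h : ∀ j ∈ l, Commute x (f j)) : Commute x (l.map f).prod := by
  induction l with
  | nil => simp
  | cons a l ih =>
    simp only [List.map_cons, List.prod_cons]
    exact (h a (by simp)).mul_right (ih fun j hj => h j (by simp [hj]))

theorem aux_factor {A ι : Type*} [Monoid A] (f : ι → A)
    (hf : ∀ i j, Commute (f i) (f j)) (i : ι) (l : List ι) (hl : l.Nodup) (hi : i ∈ l) :
    ∃ c, (l.map f).prod = f i * c ∧ ∀ x, (∀ j, j ≠ i → Commute x (f j)) → Commute x c := by
  induction l with
  | nil => simp at hi
  | cons a l ih =>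
    rw [List.nodup_cons] at hl
    by_cases hai : a = i
    · subst hai
      refine ⟨(l.map f).prod, by simp, fun x hx => aux_commute_prod f x l fun j hj => hx j ?_⟩
      rintro rfl
      exact hl.1 hj
    · have hil : i ∈ l := by
        rcases List.mem_cons.1 hi with h | h
        · exact absurd h.symm hai
        · exact h
      obtain ⟨c, hc, hx⟩ := ih hl.2 hil
      refine ⟨f a * c, ?_, fun x h => (h a hai).mul_right (hx x h)⟩
      rw [List.map_cons, List.prod_cons, hc, ← mul_assoc, (hf a i).eq, mul_assoc]

theorem aux_proj {A ι : Type*} [Ring A] [StarRing A] (f : ι → A)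
    (hf : ∀ i j, Commute (f i) (f j)) (hs : ∀ i, star (f i) = f i)
    (hp : ∀ i, f i * f i = f i) (l : List ι) :
    star (l.map f).prod = (l.map f).prod ∧
      (l.map f).prod * (l.map f).prod = (l.map f).prod := by
  induction l with
  | nil => simp
  | cons a l ih =>
    have hc : Commute (f a) (l.map f).prod := aux_commute_prod f _ l fun j _ => hf a j
    simp only [List.map_cons, List.prod_cons]
    constructor
    · rw [star_mul, ih.1, hs, hc.eq]
    · rw [mul_assoc, ← mul_assoc _ (f a), ← hc.eq, mul_assoc (f a) _ _, ih.2, ← mul_assoc, hp]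

theorem aux_pow_iso {A : Type*} [Ring A] [StarRing A] (v : A) (hv : star v * v = 1) (n : ℕ) :
    star (v ^ n) * v ^ n = 1 := by
  induction n with
  | zero => simp
  | succ n ih =>
    rw [pow_succ, star_mul, mul_assoc, ← mul_assoc _ _ v, ih, one_mul, hv]

theorem aux_prod_iso {A ι : Type*} [Ring A] [StarRing A] (f : ι → A)
    (hf : ∀ i, star (f i) * f i = 1) (l : List ι) :
    star (l.map f).prod * (l.map f).prod = 1 := by
  induction l with
  | nil => simp
  | cons a l ih =>
    simp only [List.map_cons, List.prod_cons]
    rw [star_mul, mul_assoc, ← mul_assoc _ (f a), hf, one_mul, ih]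

/-- For doubly commuting isometries `w 0, …, w N` in a unital C*-algebra, with
`R = ∏ (1 - w j (w j)*)` and `W p = ∏ (w i)^(p i)`:
(i) `(w i)* R = 0` and `R * w i = 0`;
(ii) `(W p)* R = 0 = R * W p` for `p ≠ 0`;
(iii) `(W p R (W q)*)(W a R (W b)*) = δ_{q,a} W p R (W b)*`;
(iv) `(W p R (W q)*)* = W q R (W p)*`. -/
theorem matrix_units_from_doubly_commuting_isometries
    {A : Type*} [NormedRing A] [StarRing A] [CStarRing A] [CompleteSpace A]
    (N : ℕ) (w : Fin (N + 1) → A)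
    (hiso : ∀ i, star (w i) * w i = 1)
    (hcomm : ∀ i j, i ≠ j → w i * w j = w j * w i)
    (hstarcomm : ∀ i j, i ≠ j → star (w i) * w j = w j * star (w i)) :
    (∀ i, star (w i) * defectProd w = 0 ∧ defectProd w * w i = 0) ∧
    (∀ p : Fin (N + 1) → ℕ, p ≠ 0 →
      star (multiPow w p) * defectProd w = 0 ∧ defectProd w * multiPow w p = 0) ∧
    (∀ p q a b : Fin (N + 1) → ℕ,
      (multiPow w p * defectProd w * star (multiPow w q)) *
        (multiPow w a * defectProd w * star (multiPow w b)) =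
      if q = a then multiPow w p * defectProd w * star (multiPow w b) else 0) ∧
    (∀ p q : Fin (N + 1) → ℕ,
      star (multiPow w p * defectProd w * star (multiPow w q)) =
        multiPow w q * defectProd w * star (multiPow w p)) := by
  have hc : ∀ i j, Commute (w i) (w j) := fun i j => by
    by_cases h : i = j
    · subst h; exact Commute.refl _
    · exact hcomm i j h
  have hsc : ∀ i j, i ≠ j → Commute (star (w i)) (w j) := hstarcomm
  have hfc : ∀ i j, Commute (1 - w i * star (w i)) (1 - w j * star (w j)) := fun i j => by
    by_cases h : i = j
    · subst h; exact Commute.refl _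
    · have h1 : Commute (w i * star (w i)) (w j * star (w j)) :=
        ((hc i j).mul_right (hsc j i (Ne.symm h)).symm).mul_left
          ((hsc i j h).mul_right (hc i j).star_star)
      exact ((Commute.one_left _).sub_left
        ((Commute.one_right _).sub_right h1))
  have hz : ∀ i, (1 - w i * star (w i)) * w i = 0 := fun i => by
    rw [sub_mul, mul_assoc, hiso, one_mul, mul_one, sub_self]
  have hR := aux_proj (fun i => 1 - w i * star (w i)) hfc (fun i => by simp)
    (fun i => by
      rw [mul_sub, mul_one, ← mul_assoc, hz, zero_mul, sub_zero]) (List.finRange (N + 1))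
  change star (defectProd w) = defectProd w ∧
    defectProd w * defectProd w = defectProd w at hR
  obtain ⟨hRs, hRR⟩ := hR
  have hRw : ∀ i, defectProd w * w i = 0 := fun i => by
    obtain ⟨c, h1, h2⟩ := aux_factor _ hfc i (List.finRange (N + 1)) (List.nodup_finRange _)
      (List.mem_finRange i)
    have h3 : Commute (w i) c := h2 _ fun j hj =>
      (Commute.one_right _).sub_right ((hc i j).mul_right (hsc j i hj).symm)
    unfold defectProd
    rw [h1, mul_assoc, ← h3.eq, ← mul_assoc, hz, zero_mul]
  have hRpow : ∀ i n, n ≠ 0 → defectProd w * w i ^ n = 0 := fun i n hn => by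
    obtain ⟨m, rfl⟩ := Nat.exists_eq_succ_of_ne_zero hn
    rw [Nat.succ_eq_add_one, pow_succ', ← mul_assoc, hRw, zero_mul]
  have hfac : ∀ (p : Fin (N + 1) → ℕ) i, ∃ c, multiPow w p = w i ^ p i * c ∧
      Commute (star (w i)) c ∧ Commute (w i) c := fun p i => by
    obtain ⟨c, h1, h2⟩ := aux_factor (fun i => w i ^ p i)
      (fun i j => (hc i j).pow_pow _ _) i (List.finRange (N + 1)) (List.nodup_finRange _)
      (List.mem_finRange i)
    exact ⟨c, h1, h2 _ fun j hj => (hsc i j (Ne.symm hj)).pow_right _,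
      h2 _ fun j _ => (hc i j).pow_right _⟩
  have hRW : ∀ p : Fin (N + 1) → ℕ, p ≠ 0 → defectProd w * multiPow w p = 0 := fun p hp => by
    obtain ⟨i, hi⟩ := Function.ne_iff.1 hp
    obtain ⟨c, h1, -⟩ := hfac p i
    rw [h1, ← mul_assoc, hRpow i _ hi, zero_mul]
  have hlt : ∀ (q a : Fin (N + 1) → ℕ) i, q i < a i →
      defectProd w * (star (multiPow w q) * multiPow w a) = 0 := fun q a i hi => by
    obtain ⟨c, h1, h2, -⟩ := hfac q i
    obtain ⟨d, h3, -⟩ := hfac a i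
    obtain ⟨k, hk⟩ := Nat.exists_eq_add_of_lt hi
    have h4 : Commute (w i ^ (k + 1)) (star c) := by
      have := h2.star_star
      rw [star_star] at this
      exact this.pow_left _
    have h5 : star (w i ^ q i) * w i ^ a i = w i ^ (k + 1) := by
      rw [hk, add_assoc, pow_add, ← mul_assoc, aux_pow_iso _ (hiso i), one_mul]
    calc defectProd w * (star (multiPow w q) * multiPow w a)
        = defectProd w * (star c * (star (w i ^ q i) * w i ^ a i) * d) := by
          rw [h1, h3, star_mul]; simp only [mul_assoc]
      _ = defectProd w * w i ^ (k + 1) * (star c * d) := by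
          rw [h5, ← h4.eq]; simp only [mul_assoc]
      _ = 0 := by rw [hRpow i _ (Nat.succ_ne_zero k), zero_mul]
  have hne : ∀ q a : Fin (N + 1) → ℕ, q ≠ a →
      defectProd w * (star (multiPow w q) * multiPow w a) * defectProd w = 0 := fun q a h => by
    obtain ⟨i, hi⟩ := Function.ne_iff.1 h
    rcases lt_or_gt_of_ne hi with hi | hi
    · rw [hlt q a i hi, zero_mul]
    · have := congrArg star (hlt a q i hi)
      rw [star_mul, star_mul, star_star, hRs, star_zero] at this
      rw [mul_assoc, this, mul_zero]
  have hWW : ∀ q : Fin (N + 1) → ℕ, star (multiPow w q) * multiPow w q = 1 := fun q =>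
    aux_prod_iso _ (fun i => aux_pow_iso _ (hiso i) _) _
  refine ⟨fun i => ⟨?_, hRw i⟩, fun p hp => ⟨?_, hRW p hp⟩, fun p q a b => ?_, fun p q => ?_⟩
  · have := congrArg star (hRw i)
    rwa [star_mul, hRs, star_zero] at this
  · have := congrArg star (hRW p hp)
    rwa [star_mul, hRs, star_zero] at this
  · have h1 : (multiPow w p * defectProd w * star (multiPow w q)) *
        (multiPow w a * defectProd w * star (multiPow w b)) =
        multiPow w p * (defectProd w * (star (multiPow w q) * multiPow w a) * defectProd w) *
          star (multiPow w b) := by simp only [mul_assoc]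
    rw [h1]
    split_ifs with h
    · subst h
      rw [hWW, mul_one, hRR]
    · rw [hne q a h, mul_zero, zero_mul]
  · rw [star_mul, star_mul, star_star, hRs, mul_assoc]
end

section
/- Let A be a unital C*-algebra and let w_0, …, w_N ∈ A be isometries that doubly commute, i.e. w_i w_j = w_j w_i and w_i* w_j = w_j w_i* for all i ≠ j. Set R := ∏_{j=0}^N (1 − w_j w_j*) (product in increasing order of j) and W_p := ∏_{i=0}^N w_i^{p_i} for p ∈ ℕ^{N+1}. If R ≠ 0, then W_p R W_q* ≠ 0 for all p, q ∈ ℕ^{N+1}. -/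
/-- For doubly commuting isometries `w 0, …, w N` in a unital C*-algebra, with
`R = ∏ (1 - w j (w j)*)` and `W p = ∏ (w i)^(p i)`: if `R ≠ 0` then all the matrix units
`W p * R * (W q)*` are nonzero. -/
theorem matrix_units_nonzero_of_defect_nonzero
    {A : Type*} [NormedRing A] [StarRing A] [CStarRing A] [CompleteSpace A]
    (N : ℕ) (w : Fin (N + 1) → A)
    (hiso : ∀ i, star (w i) * w i = 1)
    (hcomm : ∀ i j, i ≠ j → w i * w j = w j * w i)
    (hstarcomm : ∀ i j, i ≠ j → star (w i) * w j = w j * star (w i))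
    (hR : defectProd w ≠ 0) :
    ∀ p q : Fin (N + 1) → ℕ, multiPow w p * defectProd w * star (multiPow w q) ≠ 0 := by
  have pow_iso : ∀ (a : A), star a * a = 1 → ∀ n : ℕ, star (a ^ n) * a ^ n = 1 := by
    intro a ha n
    induction n with
    | zero => simp
    | succ k ih =>
      rw [pow_succ, star_mul, mul_assoc, ← mul_assoc (star (a ^ k)), ih, one_mul, ha]
  have list_iso : ∀ l : List A, (∀ a ∈ l, star a * a = 1) → star l.prod * l.prod = 1 := by
    intro l
    induction l with
    | nil => simp
    | cons a t ih =>
      intro h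
      have ha : star a * a = 1 := h a (by simp)
      have ht := ih (fun b hb => h b (by simp [hb]))
      rw [List.prod_cons, star_mul, mul_assoc, ← mul_assoc (star a), ha, one_mul, ht]
  have W_iso : ∀ p : Fin (N + 1) → ℕ, star (multiPow w p) * multiPow w p = 1 := by
    intro p
    apply list_iso
    intro a ha
    obtain ⟨i, _, rfl⟩ := List.mem_map.1 ha
    exact pow_iso _ (hiso i) _
  intro p q h
  apply hR
  calc defectProd w
      = (star (multiPow w p) * multiPow w p) * defectProd w
          * (star (multiPow w q) * multiPow w q) := by rw [W_iso, W_iso, one_mul, mul_one]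
    _ = star (multiPow w p) * (multiPow w p * defectProd w * star (multiPow w q))
          * multiPow w q := by simp only [mul_assoc]
    _ = 0 := by rw [h, mul_zero, zero_mul]
end
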